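/- Let A be a Banach algebra and J a closed two-sided ideal of A. Suppose that J has a bounded right approximate identity, and that there exists x₀ ∈ J such that x₀ does not lie in the closure of the set Jx₀ = {y x₀ : y ∈ J}. Then A is not approximately amenable. -/

import Mathlib

open scoped TensorProduct ENNReal
open MeasureTheory Filter

noncomputable section

/-- The projective tensor norm of an element of the algebraic tensor product `A ⊗[ℂ] A`;
the projective tensor product `A ⊗̂ A` is the completion of `A ⊗[ℂ] A` in this norm, and a
net in `A ⊗̂ A` witnessing an approximate diagonal may always be taken in the dense
subspace `A ⊗[ℂ] A`. -/
def projNorm {A : Type*} [NonUnitalNormedRing A] [NormedSpace ℂ A]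
    (u : TensorProduct ℂ A A) : ℝ :=
  sInf { r : ℝ | ∃ l : List (A × A), u = (l.map fun p => p.1 ⊗ₜ[ℂ] p.2).sum ∧
      r = (l.map fun p => ‖p.1‖ * ‖p.2‖).sum }

/-- The left `A`-bimodule action on `A ⊗ A`: `a • (x ⊗ y) = (a*x) ⊗ y`. -/
def diagL {A : Type*} [NonUnitalNormedRing A] [NormedSpace ℂ A]
    [SMulCommClass ℂ A A] [IsScalarTower ℂ A A]
    (a : A) (u : TensorProduct ℂ A A) : TensorProduct ℂ A A :=
  TensorProduct.map (LinearMap.mulLeft ℂ a) LinearMap.id u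

/-- The right `A`-bimodule action on `A ⊗ A`: `(x ⊗ y) • a = x ⊗ (y*a)`. -/
def diagR {A : Type*} [NonUnitalNormedRing A] [NormedSpace ℂ A]
    [SMulCommClass ℂ A A] [IsScalarTower ℂ A A]
    (a : A) (u : TensorProduct ℂ A A) : TensorProduct ℂ A A :=
  TensorProduct.map LinearMap.id (LinearMap.mulRight ℂ a) u

/-- The multiplication map `π : A ⊗ A → A`, `π(x ⊗ y) = x*y`. -/
def tensMul {A : Type*} [NonUnitalNormedRing A] [NormedSpace ℂ A]
    [SMulCommClass ℂ A A] [IsScalarTower ℂ A A] :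
    TensorProduct ℂ A A →ₗ[ℂ] A :=
  TensorProduct.lift (LinearMap.mul ℂ A)

/-- `A` has a (not necessarily bounded) approximate diagonal: a net `(d_α)` in `A ⊗̂ A`
with `‖a·d_α − d_α·a‖ → 0` and `‖a π(d_α) − a‖ → 0` for every `a ∈ A`.  This is formulated
via the equivalent cofinal finite-set/ε criterion (the net is then indexed by pairs
`(S, ε)` ordered by inclusion/refinement). -/
def HasApproxDiagonal (A : Type*) [NonUnitalNormedRing A] [NormedSpace ℂ A]
    [SMulCommClass ℂ A A] [IsScalarTower ℂ A A] : Prop :=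
  ∀ (S : Finset A) (ε : ℝ), 0 < ε → ∃ u : TensorProduct ℂ A A,
    ∀ a ∈ S, projNorm (diagL a u - diagR a u) < ε ∧ ‖a * tensMul u - a‖ < ε

/-- `A` is amenable: it has a bounded approximate diagonal. -/
def IsAmenable (A : Type*) [NonUnitalNormedRing A] [NormedSpace ℂ A]
    [SMulCommClass ℂ A A] [IsScalarTower ℂ A A] : Prop :=
  ∃ C : ℝ, ∀ (S : Finset A) (ε : ℝ), 0 < ε → ∃ u : TensorProduct ℂ A A,
    projNorm u ≤ C ∧
    ∀ a ∈ S, projNorm (diagL a u - diagR a u) < ε ∧ ‖a * tensMul u - a‖ < ε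

/-- `A` is approximately amenable: its forced unitization `A# = ℂ ⊕ A` (equipped with the
ℓ¹ norm `‖(λ, a)‖ = ‖λ‖ + ‖a‖`) has a, not necessarily bounded, approximate diagonal. -/
def IsApproxAmenable (A : Type*) [NonUnitalNormedRing A] [NormedSpace ℂ A]
    [SMulCommClass ℂ A A] [IsScalarTower ℂ A A] : Prop :=
  HasApproxDiagonal (WithLp 1 (Unitization ℂ A))

/-- A subset `J` of a normed algebra has a bounded right approximate identity: a norm-bounded
net `(e_α)` in `J` with `‖x - x * e_α‖ → 0` for every `x ∈ J` (equivalently, formulated via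
the cofinal finite-set/ε criterion). -/
def HasBoundedRightApproxId {A : Type*} [NonUnitalNormedRing A] (J : Set A) : Prop :=
  ∃ C : ℝ, ∀ (F : Finset A), (∀ x ∈ F, x ∈ J) → ∀ ε : ℝ, 0 < ε →
    ∃ e ∈ J, ‖e‖ ≤ C ∧ ∀ x ∈ F, ‖x - x * e‖ < ε

/-- A subset `J` of a normed algebra has a bounded left approximate identity: a norm-bounded
net `(e_α)` in `J` with `‖x - e_α * x‖ → 0` for every `x ∈ J`. -/
def HasBoundedLeftApproxId {A : Type*} [NonUnitalNormedRing A] (J : Set A) : Prop :=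
  ∃ C : ℝ, ∀ (F : Finset A), (∀ x ∈ F, x ∈ J) → ∀ ε : ℝ, 0 < ε →
    ∃ e ∈ J, ‖e‖ ≤ C ∧ ∀ x ∈ F, ‖x - e * x‖ < ε

/-- A subset `J` of a normed algebra has a (not necessarily bounded) left approximate
identity: a net `(v_β)` in `J` with `‖x - v_β * x‖ → 0` for every `x ∈ J`. -/
def HasLeftApproxId {A : Type*} [NonUnitalNormedRing A] (J : Set A) : Prop :=
  ∀ (F : Finset A), (∀ x ∈ F, x ∈ J) → ∀ ε : ℝ, 0 < ε →
    ∃ v ∈ J, ∀ x ∈ F, ‖x - v * x‖ < ε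

lemma exists_list_tmul {B : Type*} [NonUnitalNormedRing B] [NormedSpace ℂ B]
    (u : TensorProduct ℂ B B) :
    ∃ l : List (B × B), u = (l.map fun p => p.1 ⊗ₜ[ℂ] p.2).sum := by
  induction u with
  | zero => exact ⟨[], rfl⟩
  | tmul a b => exact ⟨[(a, b)], by simp⟩
  | add u v hu hv =>
    obtain ⟨l, rfl⟩ := hu
    obtain ⟨m, rfl⟩ := hv
    exact ⟨l ++ m, by simp⟩

section Sandwich

variable {B : Type*} [NonUnitalNormedRing B] [NormedSpace ℂ B]
  [SMulCommClass ℂ B B] [IsScalarTower ℂ B B]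

/-- The linear map `B ⊗ B → B` with `a ⊗ b ↦ a * e * b`. -/
def sandwich (e : B) : TensorProduct ℂ B B →ₗ[ℂ] B :=
  tensMul ∘ₗ TensorProduct.map (LinearMap.mulRight ℂ e) LinearMap.id

@[simp]
lemma sandwich_tmul (e a b : B) : sandwich e (a ⊗ₜ[ℂ] b) = a * e * b := by
  simp [sandwich, tensMul]

lemma sandwich_diagL (e x : B) (u : TensorProduct ℂ B B) :
    sandwich e (diagL x u) = x * sandwich e u := by
  induction u with
  | zero => simp [diagL]
  | tmul a b => simp [diagL, mul_assoc]
  | add u v hu hv =>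
    rw [show diagL x (u + v) = diagL x u + diagL x v from map_add _ u v]
    simp [hu, hv, mul_add]

lemma sandwich_diagR (e x : B) (u : TensorProduct ℂ B B) :
    sandwich e (diagR x u) = sandwich e u * x := by
  induction u with
  | zero => simp [diagR]
  | tmul a b => simp [diagR, mul_assoc]
  | add u v hu hv =>
    rw [show diagR x (u + v) = diagR x u + diagR x v from map_add _ u v]
    simp [hu, hv, add_mul]

lemma sandwich_mem {J : Submodule ℂ B} (hr : ∀ a ∈ J, ∀ b : B, a * b ∈ J)
    (hl : ∀ a ∈ J, ∀ b : B, b * a ∈ J) {e : B} (he : e ∈ J) (u : TensorProduct ℂ B B) :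
    sandwich e u ∈ J := by
  induction u with
  | zero => simp
  | tmul a b => simpa using hr _ (hl _ he a) b
  | add u v hu hv => simpa using J.add_mem hu hv

lemma norm_sandwich_list_le (e : B) (l : List (B × B)) :
    ‖sandwich e (l.map fun p => p.1 ⊗ₜ[ℂ] p.2).sum‖ ≤
      ‖e‖ * (l.map fun p => ‖p.1‖ * ‖p.2‖).sum := by
  induction l with
  | nil => simp
  | cons p l ih =>
    simp only [List.map_cons, List.sum_cons, map_add, sandwich_tmul, mul_add]
    refine (norm_add_le _ _).trans (add_le_add ?_ ih)
    calc ‖p.1 * e * p.2‖ ≤ ‖p.1‖ * ‖e‖ * ‖p.2‖ :=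
          (norm_mul_le _ _).trans (by gcongr; exact norm_mul_le _ _)
      _ = ‖e‖ * (‖p.1‖ * ‖p.2‖) := by ring

lemma norm_sandwich_le {e : B} {u : TensorProduct ℂ B B} {ε : ℝ} (hu : projNorm u < ε) :
    ‖sandwich e u‖ ≤ ‖e‖ * ε := by
  obtain ⟨l, hl⟩ := exists_list_tmul u
  obtain ⟨_, ⟨m, rfl, rfl⟩, hm⟩ := exists_lt_of_csInf_lt (by exact ⟨_, l, hl, rfl⟩) hu
  exact (norm_sandwich_list_le e m).trans (by gcongr)

lemma norm_mul_tensMul_sub_sandwich_le (x e : B) {η : ℝ} (l : List (B × B))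
    (h : ∀ p ∈ l, ‖x * p.1 - x * p.1 * e‖ ≤ η) :
    ‖x * tensMul (l.map fun p => p.1 ⊗ₜ[ℂ] p.2).sum -
      x * sandwich e (l.map fun p => p.1 ⊗ₜ[ℂ] p.2).sum‖ ≤ η * (l.map fun p => ‖p.2‖).sum := by
  induction l with
  | nil => simp
  | cons p l ih =>
    have hp : x * tensMul (p.1 ⊗ₜ[ℂ] p.2) - x * (p.1 * e * p.2) =
        (x * p.1 - x * p.1 * e) * p.2 := by
      simp [tensMul, sub_mul, mul_assoc]
    simp only [List.map_cons, List.sum_cons, map_add, sandwich_tmul, mul_add]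
    rw [add_sub_add_comm, hp]
    refine (norm_add_le _ _).trans (add_le_add ?_ (ih fun q hq => h q (List.mem_cons_of_mem _ hq)))
    exact (norm_mul_le _ _).trans (by gcongr; exact h p List.mem_cons_self)

/-- If `B` has an approximate diagonal and a two-sided ideal `J` has a bounded right approximate
identity, then `x` is approximated by elements of `J x`, for every `x ∈ J`. -/
theorem HasApproxDiagonal.exists_norm_sub_mul_lt (hB : HasApproxDiagonal B)
    {J : Submodule ℂ B} (hr : ∀ a ∈ J, ∀ b : B, a * b ∈ J) (hl : ∀ a ∈ J, ∀ b : B, b * a ∈ J)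
    (hJ : HasBoundedRightApproxId (J : Set B)) {x : B} (hx : x ∈ J) {δ : ℝ} (hδ : 0 < δ) :
    ∃ y ∈ J, ‖x - y * x‖ < δ := by
  classical
  obtain ⟨C, hC⟩ := hJ
  have hC₀ : 0 ≤ C := by
    obtain ⟨e, -, he, -⟩ := hC ∅ (by simp) 1 one_pos
    exact (norm_nonneg e).trans he
  set ε : ℝ := δ / (C + 3) with hε_def
  have hε : 0 < ε := by positivity
  obtain ⟨u, hu⟩ := hB {x} ε hε
  obtain ⟨hcomm, hunit⟩ := hu x (by simp)
  obtain ⟨l, rfl⟩ := exists_list_tmul u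
  set u := (l.map fun p => p.1 ⊗ₜ[ℂ] p.2).sum
  set s : ℝ := (l.map fun p => ‖p.2‖).sum
  have hs : 0 ≤ s := List.sum_nonneg <| List.forall_mem_map.2 fun _ _ => norm_nonneg _
  obtain ⟨e, he, heC, happrox⟩ := hC (l.map fun p => x * p.1).toFinset
    (by
      intro z hz
      obtain ⟨p, -, rfl⟩ := List.mem_map.1 (List.mem_toFinset.1 hz)
      exact hr x hx p.1)
    (ε / (s + 1)) (by positivity)
  refine ⟨sandwich e u, sandwich_mem hr hl he u, ?_⟩
  have h₁ : ‖x * tensMul u - x * sandwich e u‖ ≤ ε := by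
    refine (norm_mul_tensMul_sub_sandwich_le x e (η := ε / (s + 1)) l fun p hp =>
      (happrox _ (List.mem_toFinset.2 (List.mem_map_of_mem hp))).le).trans ?_
    rw [div_mul_eq_mul_div, div_le_iff₀ (by positivity)]
    gcongr
    linarith
  have h₂ : ‖x * sandwich e u - sandwich e u * x‖ ≤ C * ε := by
    rw [← sandwich_diagL, ← sandwich_diagR, ← map_sub]
    exact (norm_sandwich_le hcomm).trans (by gcongr)
  have h₃ : ‖x - x * tensMul u‖ < ε := by rwa [norm_sub_rev]
  calc ‖x - sandwich e u * x‖
      ≤ ‖x - x * tensMul u‖ + ‖x * tensMul u - x * sandwich e u‖ +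
          ‖x * sandwich e u - sandwich e u * x‖ := by
        refine le_trans (le_of_eq ?_) (norm_add₃_le)
        congr 1
        abel
    _ < ε + ε + C * ε + ε := by linarith
    _ = δ := by rw [hε_def]; field_simp; ring

end Sandwich

section Unitization

variable {A : Type*} [NonUnitalNormedRing A] [NormedSpace ℂ A]
  [SMulCommClass ℂ A A] [IsScalarTower ℂ A A]

/-- The linear embedding of `A` in its forced unitization with the `ℓ¹` norm. -/
def inrL1 : A →ₗ[ℂ] WithLp 1 (Unitization ℂ A) :=
  (WithLp.linearEquiv 1 ℂ (Unitization ℂ A)).symm ∘ₗ Unitization.inrHom ℂ ℂ A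

lemma norm_inrL1 (a : A) : ‖inrL1 a‖ = ‖a‖ :=
  WithLp.unitization_norm_inr a

lemma inrL1_mul (a b : A) : inrL1 (a * b) = inrL1 a * inrL1 b :=
  congrArg (WithLp.toLp 1) (Unitization.inr_mul ℂ a b)

lemma inrL1_mul_right (a : A) (b : WithLp 1 (Unitization ℂ A)) :
    inrL1 a * b = inrL1 ((WithLp.ofLp b).fst • a + a * (WithLp.ofLp b).snd) :=
  congrArg (WithLp.toLp 1) <| show (a : Unitization ℂ A) * WithLp.ofLp b = _ by
    ext <;> simp

lemma inrL1_mul_left (a : A) (b : WithLp 1 (Unitization ℂ A)) :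
    b * inrL1 a = inrL1 ((WithLp.ofLp b).fst • a + (WithLp.ofLp b).snd * a) :=
  congrArg (WithLp.toLp 1) <| show WithLp.ofLp b * (a : Unitization ℂ A) = _ by
    ext <;> simp

lemma HasBoundedRightApproxId.map_inrL1 {J : Submodule ℂ A}
    (hJ : HasBoundedRightApproxId (J : Set A)) :
    HasBoundedRightApproxId (J.map inrL1 : Set (WithLp 1 (Unitization ℂ A))) := by
  classical
  obtain ⟨C, hC⟩ := hJ
  refine ⟨C, fun F hF ε hε => ?_⟩
  have hF' : ∀ x ∈ F, ∃ a ∈ J, inrL1 a = x := hF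
  obtain ⟨e, he, heC, happrox⟩ := hC (F.image fun x => (WithLp.ofLp x).snd)
    (by
      intro z hz
      obtain ⟨x, hx, rfl⟩ := Finset.mem_image.1 hz
      obtain ⟨a, ha, rfl⟩ := hF' x hx
      exact ha) ε hε
  refine ⟨inrL1 e, ⟨e, he, rfl⟩, (norm_inrL1 e).trans_le heC, fun x hx => ?_⟩
  obtain ⟨a, -, rfl⟩ := hF' x hx
  rw [← inrL1_mul, ← map_sub, norm_inrL1]
  exact happrox a (Finset.mem_image_of_mem (fun x => (WithLp.ofLp x).snd) hx)

end Unitization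

/-- If a Banach algebra `A` has a closed two-sided ideal `J` with a bounded right approximate
identity and some `x₀ ∈ J` with `x₀ ∉ closure (J x₀)`, then `A` is not approximately
amenable. -/
theorem obstruction_to_approximate_amenability
    {A : Type*} [NonUnitalNormedRing A] [NormedSpace ℂ A]
    [SMulCommClass ℂ A A] [IsScalarTower ℂ A A] [CompleteSpace A]
    (J : Submodule ℂ A) (hJclosed : IsClosed (J : Set A))
    (hJmul_right : ∀ a ∈ J, ∀ b : A, a * b ∈ J)
    (hJmul_left : ∀ a ∈ J, ∀ b : A, b * a ∈ J)
    (hRAI : HasBoundedRightApproxId (J : Set A))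
    (x₀ : A) (hx₀ : x₀ ∈ J)
    (hx₀' : x₀ ∉ closure {z : A | ∃ y ∈ J, z = y * x₀}) :
    ¬ IsApproxAmenable A := by
  intro h
  obtain ⟨δ, hδ, hdist⟩ : ∃ δ > 0, ∀ y ∈ J, δ ≤ ‖x₀ - y * x₀‖ := by
    rw [Metric.mem_closure_iff] at hx₀'
    push Not at hx₀'
    obtain ⟨δ, hδ, hdist⟩ := hx₀'
    exact ⟨δ, hδ, fun y hy => by simpa [dist_eq_norm] using hdist _ ⟨y, hy, rfl⟩⟩
  obtain ⟨_, ⟨y, hy, rfl⟩, hlt⟩ := HasApproxDiagonal.exists_norm_sub_mul_lt h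
    (J := J.map inrL1)
    (by
      rintro _ ⟨a, ha, rfl⟩ b
      exact ⟨_, J.add_mem (J.smul_mem _ ha) (hJmul_right a ha _), (inrL1_mul_right a b).symm⟩)
    (by
      rintro _ ⟨a, ha, rfl⟩ b
      exact ⟨_, J.add_mem (J.smul_mem _ ha) (hJmul_left a ha _), (inrL1_mul_left a b).symm⟩)
    hRAI.map_inrL1 ⟨x₀, hx₀, rfl⟩ hδ
  rw [← inrL1_mul, ← map_sub, norm_inrL1] at hlt
  exact (hdist y hy).not_gt hlt
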